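/- arXiv:1205.6671 — 2 statements merged into one kernel-verified Lean document; each statement's English description precedes it below -/
import Mathlib

section
/- Let I be a proper nonzero monomial ideal of P. Then I is quasi-stable if and only if for every associated prime ideal 𝔭 ∈ Ass(P/I) there exists an integer 1 ≤ j ≤ n such that 𝔭 = ⟨x_j, x_{j+1},…, x_n⟩. -/
open MvPolynomial

/-- The (0-based) class of a nonzero exponent vector: the smallest index with
nonzero entry.  (The variables `x_1, …, x_n` of the paper are `X 0, …, X (n-1)`.) -/
noncomputable def cls {n : ℕ} (μ : Fin n →₀ ℕ) : ℕ :=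
  sInf {i : ℕ | ∃ hi : i < n, μ ⟨i, hi⟩ ≠ 0}

/-- `x^μ` involutively divides `x^ν` : it divides it and the quotient only involves
the multiplicative variables `x_1, …, x_{cls μ}` of `x^μ`. -/
def InvDiv {n : ℕ} (μ ν : Fin n →₀ ℕ) : Prop :=
  μ ≤ ν ∧ ∀ j : Fin n, ν j ≠ μ j → (j : ℕ) ≤ cls μ

/-- The exponent of the leading term of `f` with respect to the monomial order `m`. -/
noncomputable def ldeg {n : ℕ} {K : Type*} [Field K] (m : MonomialOrder (Fin n))
    (f : MvPolynomial (Fin n) K) : Fin n →₀ ℕ :=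
  m.toSyn.symm (f.support.sup fun μ => m.toSyn μ)

/-- The leading ideal `lt(I)` of an ideal `I` with respect to `m`. -/
noncomputable def ltIdeal {n : ℕ} {K : Type*} [Field K] (m : MonomialOrder (Fin n))
    (I : Ideal (MvPolynomial (Fin n) K)) : Ideal (MvPolynomial (Fin n) K) :=
  Ideal.span {g | ∃ f ∈ I, f ≠ 0 ∧ g = monomial (ldeg m f) (1 : K)}

/-- `H` is a (finite, monomial) Pommaret basis of the monomial ideal `I`:
it generates `I` and every monomial of `I` has a unique involutive divisor in `H`. -/
def IsMonPB {n : ℕ} {K : Type*} [Field K] (H : Set (Fin n →₀ ℕ))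
    (I : Ideal (MvPolynomial (Fin n) K)) : Prop :=
  H.Finite ∧ I = Ideal.span ((fun μ => monomial μ (1 : K)) '' H) ∧
    ∀ ν : Fin n →₀ ℕ, monomial ν (1 : K) ∈ I → ∃! μ, μ ∈ H ∧ InvDiv μ ν

/-- `H` is a Pommaret basis of the polynomial ideal `I` w.r.t. the monomial order `m`:
its elements lie in `I`, are nonzero with pairwise distinct leading terms, and the
leading terms form a Pommaret basis of the leading ideal. -/
def IsPB {n : ℕ} {K : Type*} [Field K] (m : MonomialOrder (Fin n))
    (H : Finset (MvPolynomial (Fin n) K)) (I : Ideal (MvPolynomial (Fin n) K)) : Prop :=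
  (∀ h ∈ H, h ∈ I) ∧ (∀ h ∈ H, h ≠ 0) ∧
    Set.InjOn (fun h : MvPolynomial (Fin n) K => ldeg m h) ↑H ∧
    IsMonPB ((fun h : MvPolynomial (Fin n) K => ldeg m h) '' ↑H) (ltIdeal m I)

/-- `m` is the degree reverse lexicographic order (with the reversed conventions of the
paper: for equal degrees, `μ ≺ ν` iff the first nonvanishing entry of `μ - ν` is positive). -/
def IsRevLex {n : ℕ} (m : MonomialOrder (Fin n)) : Prop :=
  ∀ μ ν : Fin n →₀ ℕ, m.toSyn μ < m.toSyn ν ↔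
    ((μ.sum fun _ e => e) < (ν.sum fun _ e => e) ∨
      ((μ.sum fun _ e => e) = (ν.sum fun _ e => e) ∧
        ∃ i : Fin n, ν i < μ i ∧ ∀ j : Fin n, j < i → μ j = ν j))

/-- `I` is a homogeneous ideal. -/
def IsHomIdeal {n : ℕ} {K : Type*} [Field K] (I : Ideal (MvPolynomial (Fin n) K)) : Prop :=
  ∃ S : Set (MvPolynomial (Fin n) K), (∀ f ∈ S, ∃ d, f.IsHomogeneous d) ∧ I = Ideal.span S

/-- `I` is a monomial ideal. -/
def IsMonIdeal {n : ℕ} {K : Type*} [Field K] (I : Ideal (MvPolynomial (Fin n) K)) : Prop :=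
  ∃ S : Set (Fin n →₀ ℕ), I = Ideal.span ((fun μ => monomial μ (1 : K)) '' S)

/-- A monomial ideal is quasi-stable if it possesses a finite Pommaret basis. -/
def QuasiStable {n : ℕ} {K : Type*} [Field K] (I : Ideal (MvPolynomial (Fin n) K)) : Prop :=
  ∃ H : Set (Fin n →₀ ℕ), IsMonPB H I

/-- Combinatorial quasi-stability. -/
def QSt {n : ℕ} (M : Set (Fin n →₀ ℕ)) : Prop :=
  ∀ (ν : Fin n →₀ ℕ) (i j : Fin n) (a : ℕ), i < j → ν + Finsupp.single i a ∈ M →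
    ∃ s : ℕ, ν + Finsupp.single j s ∈ M

lemma cls_spec {n : ℕ} {μ : Fin n →₀ ℕ} (h : μ ≠ 0) :
    ∃ c : Fin n, cls μ = c ∧ μ c ≠ 0 ∧ ∀ j, j < c → μ j = 0 := by
  have hne : {i : ℕ | ∃ hi : i < n, μ ⟨i, hi⟩ ≠ 0}.Nonempty := by
    obtain ⟨i, hi⟩ := Finsupp.ne_iff.1 h
    exact ⟨i, i.2, hi⟩
  obtain ⟨hc, hc'⟩ := Nat.sInf_mem hne
  refine ⟨⟨_, hc⟩, rfl, hc', fun j hj => ?_⟩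
  by_contra hne'
  have : sInf {i : ℕ | ∃ hi : i < n, μ ⟨i, hi⟩ ≠ 0} ≤ j := Nat.sInf_le ⟨j.2, hne'⟩
  have h2 := Fin.lt_def.1 hj
  simp only at h2
  omega

lemma qst_of_pb {n : ℕ} {M H : Set (Fin n →₀ ℕ)} (hM : IsUpperSet M) (h0 : 0 ∉ M)
    (hf : H.Finite) (hHM : H ⊆ M) (hex : ∀ ν ∈ M, ∃ μ, μ ∈ H ∧ InvDiv μ ν) : QSt M := by
  intro ν i j a hij hν
  obtain ⟨b, hb⟩ := hf.bddAbove
  have hmem : ν + Finsupp.single i a + Finsupp.single j (b j + 1) ∈ M :=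
    hM (by simp) hν
  obtain ⟨h, hH, hle, hdiv⟩ := hex _ hmem
  have hh0 : h ≠ 0 := by rintro rfl; exact h0 (hHM hH)
  obtain ⟨c, hc, hc1, hc2⟩ := cls_spec hh0
  have hbj : h j ≤ b j := hb hH j
  have hjc : (j : ℕ) ≤ cls h := by
    apply hdiv
    simp [hij.ne]
    omega
  rw [hc] at hjc
  have hi0 : h i = 0 := hc2 i (lt_of_lt_of_le hij hjc)
  refine ⟨b j + 1, hM (fun k => ?_) (hHM hH)⟩
  have := hle k
  by_cases hk : k = i
  · subst hk; rw [hi0]; exact Nat.zero_le _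
  · simpa [Finsupp.single_apply, Ne.symm hk] using this

/-- the candidate Pommaret basis -/
def PBset {n : ℕ} (M : Set (Fin n →₀ ℕ)) : Set (Fin n →₀ ℕ) :=
  {μ | μ ∈ M ∧ ∀ c : Fin n, cls μ = c → μ - Finsupp.single c 1 ∉ M}

lemma pb_exists {n : ℕ} {M : Set (Fin n →₀ ℕ)} (h0 : 0 ∉ M) :
    ∀ (d : ℕ) (ν : Fin n →₀ ℕ), ν.degree = d → ν ∈ M → ∃ μ, μ ∈ PBset M ∧ InvDiv μ ν := by
  intro d
  induction d with
  | zero =>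
    intro ν hd hν
    rw [Finsupp.degree_eq_zero_iff] at hd
    exact absurd (hd ▸ hν) h0
  | succ d ih =>
    intro ν hd hν
    have hν0 : ν ≠ 0 := by rintro rfl; exact h0 hν
    by_cases hm : ν ∈ PBset M
    · exact ⟨ν, hm, le_rfl, fun j hj => absurd rfl hj⟩
    obtain ⟨c, hc, hc1, hc2⟩ := cls_spec hν0
    have hm' : ν - Finsupp.single c 1 ∈ M := by
      by_contra hcon
      refine hm ⟨hν, fun c' hc' => ?_⟩
      have : c' = c := Fin.ext (hc'.symm.trans hc)
      rwa [this]
    have hadd : ν - Finsupp.single c 1 + Finsupp.single c 1 = ν := by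
      apply tsub_add_cancel_of_le
      simp; omega
    have hdeg : (ν - Finsupp.single c 1).degree = d := by
      have := congrArg Finsupp.degree hadd
      simp at this
      omega
    obtain ⟨μ, hμ, hle, hdiv⟩ := ih _ hdeg hm'
    refine ⟨μ, hμ, hle.trans tsub_le_self, fun j hj => ?_⟩
    have hμ0 : μ ≠ 0 := by rintro rfl; exact h0 hμ.1
    obtain ⟨c', hc', hc1', hc2'⟩ := cls_spec hμ0
    by_cases hjc : j = c
    · subst hjc
      rw [hc']
      by_contra hlt
      have h1 := hc2 c' (Fin.lt_def.2 (by omega))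
      have h2 := hle c'
      simp [h1] at h2
      exact hc1' h2
    · apply hdiv
      simpa [Finsupp.single_apply, Ne.symm hjc] using hj

lemma pb_unique_aux {n : ℕ} {M : Set (Fin n →₀ ℕ)} (hM : IsUpperSet M) (h0 : 0 ∉ M)
    {ν h h' : Fin n →₀ ℕ} (hh : h ∈ PBset M) (hh' : h' ∈ PBset M) (hd : InvDiv h ν)
    (hd' : InvDiv h' ν) (hc : cls h ≤ cls h')
    (hlt : cls h = cls h' → ∀ c : Fin n, cls h = c → h' c ≤ h c) : h = h' := by
  have hμ0 : h ≠ 0 := by rintro rfl; exact h0 hh.1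
  have hμ0' : h' ≠ 0 := by rintro rfl; exact h0 hh'.1
  obtain ⟨c, hc0, hc1, hc2⟩ := cls_spec hμ0
  obtain ⟨c', hc0', hc1', hc2'⟩ := cls_spec hμ0'
  rw [hc0, hc0'] at hc
  have hab : ∀ j, c < j → h j = ν j := by
    intro j hj
    by_contra hne
    have := hd.2 j (Ne.symm hne)
    rw [hc0] at this
    exact absurd hj (not_lt.2 this)
  have key : ∀ j, j ≠ c → h' j ≤ h j := by
    intro j hj
    rcases lt_or_gt_of_ne hj with hj | hj
    · rw [hc2' j (lt_of_lt_of_le hj hc)]; exact Nat.zero_le _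
    · rw [hab j hj]; exact hd'.1 j
  have hcc : ¬ (h' c < h c) := by
    intro hl
    refine hh.2 c hc0 (hM (fun j => ?_) hh'.1)
    by_cases hj : j = c
    · subst hj; simp; omega
    · simpa [Finsupp.single_apply, Ne.symm hj] using key j hj
  have hcc2 : c = c' := by
    by_contra hne
    apply hcc
    rw [hc2' c (lt_of_le_of_ne hc hne)]
    omega
  subst hcc2
  ext j
  rcases lt_trichotomy j c with hj | hj | hj
  · rw [hc2 j hj, hc2' j hj]
  · subst hj
    have := hlt (hc0.trans hc0'.symm) j hc0
    omega
  · rw [hab j hj]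
    by_contra hne
    have := hd'.2 j hne
    rw [hc0'] at this
    exact absurd hj (not_lt.2 this)

lemma pb_unique {n : ℕ} {M : Set (Fin n →₀ ℕ)} (hM : IsUpperSet M) (h0 : 0 ∉ M)
    {ν h h' : Fin n →₀ ℕ} (hh : h ∈ PBset M) (hh' : h' ∈ PBset M) (hd : InvDiv h ν)
    (hd' : InvDiv h' ν) : h = h' := by
  rcases lt_trichotomy (cls h) (cls h') with hl | hl | hl
  · exact pb_unique_aux hM h0 hh hh' hd hd' hl.le (fun e => absurd e hl.ne)
  · have hμ0 : h ≠ 0 := by rintro rfl; exact h0 hh.1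
    obtain ⟨c, hc0, -, -⟩ := cls_spec hμ0
    rcases le_total (h' c) (h c) with hle | hle
    · refine pb_unique_aux hM h0 hh hh' hd hd' hl.le (fun _ c' hc' => ?_)
      rwa [show c' = c from Fin.ext (hc'.symm.trans hc0)]
    · refine (pb_unique_aux hM h0 hh' hh hd' hd hl.ge (fun _ c' hc' => ?_)).symm
      rwa [show c' = c from Fin.ext (hc'.symm.trans (hl.symm.trans hc0))]
  · exact (pb_unique_aux hM h0 hh' hh hd' hd hl.le (fun e => absurd e hl.ne)).symm

lemma pb_finite {n : ℕ} {M : Set (Fin n →₀ ℕ)} (hM : IsUpperSet M) (h0 : 0 ∉ M)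
    (hQ : QSt M) : (PBset M).Finite := by
  have hG : {x | Minimal (· ∈ M) x}.Finite :=
    WellQuasiOrderedLE.finite_of_isAntichain (setOfPred_minimal_antichain _)
  have hev : ∀ g ∈ {x | Minimal (· ∈ M) x}, ∀ i j : Fin n, ∀ᶠ s in Filter.atTop,
      g i ≤ s ∧ (i < j → g.erase i + Finsupp.single j s ∈ M) := by
    intro g hg i j
    refine (Filter.eventually_ge_atTop (g i)).and ?_
    by_cases hij : i < j
    · obtain ⟨s, hs⟩ := hQ (g.erase i) i j (g i) hij (by
        rw [add_comm, Finsupp.single_add_erase]; exact hg.1)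
      filter_upwards [Filter.eventually_ge_atTop s] with t ht _
      refine hM ?_ hs
      gcongr
    · exact Filter.Eventually.of_forall fun s h => absurd h hij
  have hev2 : ∀ᶠ s in Filter.atTop, ∀ g ∈ {x | Minimal (· ∈ M) x}, ∀ i j : Fin n,
      g i ≤ s ∧ (i < j → g.erase i + Finsupp.single j s ∈ M) := by
    rw [Filter.eventually_all_finite hG]
    intro g hg
    rw [Filter.eventually_all]
    intro i
    rw [Filter.eventually_all]
    exact hev g hg i
  obtain ⟨B, hB⟩ := hev2.exists
  refine (Set.finite_Iic (Finsupp.equivFunOnFinite.symm fun _ : Fin n => B + B)).subset ?_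
  intro h hh j
  show h j ≤ B + B
  have hμ0 : h ≠ 0 := by rintro rfl; exact h0 hh.1
  obtain ⟨c, hc0, hc1, hc2⟩ := cls_spec hμ0
  obtain ⟨g, hgh, hg⟩ := exists_minimal_le_of_wellFoundedLT (· ∈ M) h hh.1
  have hgc : h c ≤ g c := by
    by_contra hlt
    refine hh.2 c hc0 (hM (fun k => ?_) hg.1)
    have := hgh k
    by_cases hk : k = c
    · subst hk; simp; omega
    · simpa [Finsupp.single_apply, Ne.symm hk] using this
  rcases lt_trichotomy j c with hj | hj | hj
  · rw [hc2 j hj]; exact Nat.zero_le _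
  · subst hj
    have := (hB g hg j j).1
    omega
  · by_contra hlt
    refine hh.2 c hc0 (hM (fun k => ?_) ((hB g hg c j).2 hj))
    have h1 := hgh k
    have h2 := (hB g hg k j).1
    by_cases hk : k = c
    · subst hk; simp [hj.ne']
    · by_cases hkj : k = j
      · subst hkj
        simp [Finsupp.single_apply, Ne.symm hk, Finsupp.erase_ne hk]
        omega
      · simpa [Finsupp.single_apply, Ne.symm hk, Ne.symm hkj, Finsupp.erase_ne hk] using h1

lemma assoc_iff {n : ℕ} {K : Type*} [Field K] (I p : Ideal (MvPolynomial (Fin n) K)) :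
    p ∈ associatedPrimes (MvPolynomial (Fin n) K) (MvPolynomial (Fin n) K ⧸ I) ↔
      p.IsPrime ∧ ∃ f, ∀ g, g ∈ p ↔ g * f ∈ I := by
  have key : ∀ f g : MvPolynomial (Fin n) K,
      g ∈ (⊥ : Submodule (MvPolynomial (Fin n) K) (MvPolynomial (Fin n) K ⧸ I)).colon
        {Ideal.Quotient.mk I f} ↔ g * f ∈ I := by
    intro f g
    rw [Submodule.mem_colon_singleton, Submodule.mem_bot, ← Ideal.Quotient.eq_zero_iff_mem,
      map_mul]
    rfl
  rw [AssociatedPrimes.mem_iff, IsAssociatedPrime, Submodule.isAssociatedPrime_iff]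
  refine and_congr_right fun _ => ⟨?_, ?_⟩
  · rintro ⟨x, rfl⟩
    obtain ⟨f, rfl⟩ := Ideal.Quotient.mk_surjective x
    exact ⟨f, key f⟩
  · rintro ⟨f, hf⟩
    exact ⟨Ideal.Quotient.mk I f, Ideal.ext fun g => (hf g).trans (key f g).symm⟩

/-- the colon ideal by a single element -/
def colonE {R : Type*} [CommRing R] (I : Ideal R) (f : R) : Ideal R where
  carrier := {g | g * f ∈ I}
  zero_mem' := by simp
  add_mem' := by
    intro a b ha hb
    simp only [Set.mem_ofPred_eq, add_mul] at *
    exact I.add_mem ha hb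
  smul_mem' := by
    intro c a ha
    simp only [Set.mem_ofPred_eq, smul_eq_mul, mul_assoc] at *
    exact I.mul_mem_left c ha

lemma mem_colonE {R : Type*} [CommRing R] {I : Ideal R} {f g : R} :
    g ∈ colonE I f ↔ g * f ∈ I := Iff.rfl

lemma exists_prime_colon {R : Type*} [CommRing R] [IsNoetherianRing R] (I : Ideal R)
    (u v f : R) (a : ℕ) (h1 : u ^ a * f ∈ I) (h2 : ∀ s : ℕ, v ^ s * f ∉ I) :
    ∃ f', (colonE I f').IsPrime ∧ u ∈ colonE I f' ∧ v ∉ colonE I f' := by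
  let S : Set (Ideal R) :=
    {J | ∃ y, J = colonE I y ∧ u ^ a * y ∈ I ∧ ∀ s : ℕ, v ^ s * y ∉ I}
  obtain ⟨J, ⟨y, rfl, hy1, hy2⟩, hmax⟩ :=
    set_has_maximal_iff_noetherian.2 (inferInstance : IsNoetherian R R) S ⟨_, f, rfl, h1, h2⟩
  have hmax' : ∀ b, (∀ s : ℕ, v ^ s * (b * y) ∉ I) → ∀ g, g * (b * y) ∈ I → g * y ∈ I := by
    intro b hb g hg
    have hle : colonE I y ≤ colonE I (b * y) := by
      intro x hx
      rw [mem_colonE] at *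
      rw [mul_left_comm]
      exact I.mul_mem_left b hx
    have hmem : colonE I (b * y) ∈ S := ⟨_, rfl, hle hy1, hb⟩
    have := hmax _ hmem
    have heq : colonE I y = colonE I (b * y) := by
      by_contra hne
      exact this (lt_of_le_of_ne hle hne)
    have : g ∈ colonE I (b * y) := hg
    rw [← heq] at this
    exact this
  have hv : ∀ (s : ℕ) g, v ^ s * (g * y) ∈ I → g * y ∈ I := by
    intro s g hg
    refine hmax' (v ^ s) (fun t => ?_) g ?_
    · rw [← mul_assoc, ← pow_add]; exact hy2 _
    · rwa [mul_left_comm]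
  have hprime : (colonE I y).IsPrime := by
    refine ⟨fun htop => hy2 0 ?_, ?_⟩
    · have : (1 : R) ∈ colonE I y := htop ▸ Submodule.mem_top
      simpa [mem_colonE] using this
    · intro g b hgb
      by_cases hb : b * y ∈ I
      · exact Or.inr hb
      · left
        refine hmax' b (fun s hs => hb (hv s b hs)) g ?_
        rw [← mul_assoc]; exact hgb
  refine ⟨y, hprime, hprime.mem_of_pow_mem a hy1, fun hvm => hy2 1 ?_⟩
  simpa [mem_colonE] using hvm

/-- Exponents of monomials in `I`. -/
def expSet {n : ℕ} {K : Type*} [Field K] (I : Ideal (MvPolynomial (Fin n) K)) :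
    Set (Fin n →₀ ℕ) := {ν | monomial ν (1 : K) ∈ I}

lemma expSet_upper {n : ℕ} {K : Type*} [Field K] (I : Ideal (MvPolynomial (Fin n) K)) :
    IsUpperSet (expSet I) := by
  intro a b hab ha
  obtain ⟨c, rfl⟩ := le_iff_exists_add.1 hab
  have := I.mul_mem_left (monomial c 1) ha
  rw [monomial_mul, one_mul, add_comm] at this
  exact this

lemma monomial_mem_iff {n : ℕ} {K : Type*} [Field K] (I : Ideal (MvPolynomial (Fin n) K))
    (ν : Fin n →₀ ℕ) (c : K) (hc : c ≠ 0) : monomial ν c ∈ I ↔ ν ∈ expSet I := by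
  constructor
  · intro h
    have := I.mul_mem_left (C c⁻¹) h
    rw [C_mul_monomial, inv_mul_cancel₀ hc] at this
    exact this
  · intro h
    have := I.mul_mem_left (C c) h
    rw [C_mul_monomial, mul_one] at this
    exact this

lemma mem_iff_supp {n : ℕ} {K : Type*} [Field K] {I : Ideal (MvPolynomial (Fin n) K)}
    (hI : IsMonIdeal I) (f : MvPolynomial (Fin n) K) :
    f ∈ I ↔ ∀ ν ∈ f.support, ν ∈ expSet I := by
  constructor
  · obtain ⟨S, rfl⟩ := hI
    intro hf ν hν
    obtain ⟨s, hs, hle⟩ := mem_ideal_span_monomial_image.1 hf ν hν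
    exact expSet_upper _ hle (Ideal.subset_span ⟨s, hs, rfl⟩)
  · intro h
    rw [f.as_sum]
    exact I.sum_mem fun ν hν => (monomial_mem_iff I ν _ (mem_support_iff.1 hν)).2 (h ν hν)

lemma X_mem_span {n : ℕ} {K : Type*} [Field K] (j i : Fin n) :
    (X i : MvPolynomial (Fin n) K) ∈ Ideal.span {q | ∃ i : Fin n, j ≤ i ∧ q = X i} ↔ j ≤ i := by
  have hset : {q : MvPolynomial (Fin n) K | ∃ i : Fin n, j ≤ i ∧ q = X i}
      = X '' {i | j ≤ i} := by
    ext q; simp [eq_comm]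
  constructor
  · intro h
    rw [hset, mem_ideal_span_X_image] at h
    obtain ⟨k, hk, hk2⟩ := h (Finsupp.single i 1) (by simp [support_X])
    rw [Finsupp.single_apply_ne_zero] at hk2
    rw [← hk2.1]; exact hk
  · intro h
    exact Ideal.subset_span ⟨i, h, rfl⟩

lemma qst_of_ass {n : ℕ} {K : Type*} [Field K] (I : Ideal (MvPolynomial (Fin n) K))
    (h : ∀ p ∈ associatedPrimes (MvPolynomial (Fin n) K) (MvPolynomial (Fin n) K ⧸ I),
        ∃ j : Fin n, p = Ideal.span {q | ∃ i : Fin n, j ≤ i ∧ q = X i}) : QSt (expSet I) := by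
  intro ν i j a hij hν
  have hmul : ∀ (k : Fin n) (s : ℕ), (X k : MvPolynomial (Fin n) K) ^ s * monomial ν 1
      = monomial (ν + Finsupp.single k s) 1 := by
    intro k s
    rw [X_pow_eq_monomial, monomial_mul, one_mul, add_comm]
  by_contra hcon
  push Not at hcon
  obtain ⟨f, hp, hi, hj⟩ := exists_prime_colon I (X i) (X j) (monomial ν 1) a
    (by rw [hmul]; exact hν) (fun s hs => hcon s (by rw [hmul] at hs; exact hs))
  obtain ⟨k, hk⟩ := h _ ((assoc_iff I _).2 ⟨hp, f, fun g => Iff.rfl⟩)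
  rw [hk, X_mem_span] at hi hj
  exact hj (hi.trans hij.le)

set_option maxHeartbeats 1000000 in
/-- Associated primes of monomial ideals are monomial. -/
lemma prime_mon {n : ℕ} {K : Type*} [Field K] {I : Ideal (MvPolynomial (Fin n) K)}
    (hI : IsMonIdeal I) {p : Ideal (MvPolynomial (Fin n) K)} (hp : p.IsPrime)
    (hf : ∃ f, ∀ g, g ∈ p ↔ g * f ∈ I) (g : MvPolynomial (Fin n) K) (hg : g ∈ p) :
    ∀ ν ∈ g.support, ν ∈ expSet p := by
  classical
  obtain ⟨f, hf, hmin⟩ : ∃ f, (∀ g, g ∈ p ↔ g * f ∈ I) ∧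
      ∀ f', (∀ g, g ∈ p ↔ g * f' ∈ I) → f.support.card ≤ f'.support.card := by
    have hne : {f | ∀ g, g ∈ p ↔ g * f ∈ I}.Nonempty := hf
    obtain ⟨f, hf, hmin⟩ := (measure fun f : MvPolynomial (Fin n) K =>
      f.support.card).wf.has_min _ hne
    exact ⟨f, hf, fun f' hf' => not_lt.1 (hmin f' hf')⟩
  have hf0 : f ≠ 0 := by
    rintro rfl
    exact hp.ne_top ((Ideal.eq_top_iff_one _).2 ((hf 1).2 (by simp)))
  let g' := ∑ ν ∈ g.support.filter (fun ν => ν ∉ expSet p), monomial ν (coeff ν g)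
  have hg'supp : ∀ ν ∈ g'.support, ν ∉ expSet p ∧ ν ∈ g.support := by
    intro ν hν
    obtain ⟨μ, hμ, hμ2⟩ := Finset.mem_biUnion.1 (support_sum hν)
    have := support_monomial_subset hμ2
    rw [Finset.mem_singleton] at this
    subst this
    exact ⟨(Finset.mem_filter.1 hμ).2, (Finset.mem_filter.1 hμ).1⟩
  have hsplit : g = ∑ ν ∈ g.support.filter (fun ν => ν ∈ expSet p), monomial ν (coeff ν g)
      + g' := by
    conv_lhs => rw [g.as_sum]
    exact (Finset.sum_filter_add_sum_filter_not _ _ _).symm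
  have hrest : ∑ ν ∈ g.support.filter (fun ν => ν ∈ expSet p), monomial ν (coeff ν g) ∈ p := by
    refine p.sum_mem fun ν hν => ?_
    rw [Finset.mem_filter] at hν
    exact (monomial_mem_iff p ν _ (mem_support_iff.1 hν.1)).2 hν.2
  have hg'p : g' ∈ p := by
    rw [hsplit] at hg
    exact (p.add_mem_iff_right hrest).1 hg
  have hg'0 : g' = 0 := by
    by_contra hg'0
    obtain ⟨m⟩ : Nonempty (MonomialOrder (Fin n)) := ⟨MonomialOrder.lex⟩
    have hα := hg'supp _ (m.degree_mem_support hg'0)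
    set α := m.degree g'
    set β := m.degree f with hβ
    have hprod : g' * f ∈ I := (hf g').1 hg'p
    have hαβ : α + β ∈ expSet I := by
      have := (mem_iff_supp hI _).1 hprod (m.degree (g' * f))
        (m.degree_mem_support (mul_ne_zero hg'0 hf0))
      rwa [m.degree_mul hg'0 hf0] at this
    let r := f - monomial β (coeff β f)
    have hrsupp : r.support ⊆ f.support.erase β := by
      intro γ hγ
      rw [mem_support_iff] at hγ
      simp only [r, coeff_sub, coeff_monomial] at hγ
      rw [Finset.mem_erase, mem_support_iff]
      by_cases hb : β = γ
      · subst hb; simp at hγ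
      · simp [hb] at hγ
        exact ⟨Ne.symm hb, hγ⟩
    have hβf : β ∈ f.support := m.degree_mem_support hf0
    have hcard : (monomial α (1 : K) * r).support.card < f.support.card := by
      have h1 : (monomial α (1 : K) * r).support ⊆ r.support.image (α + ·) := by
        intro γ hγ
        have := support_mul _ _ hγ
        obtain ⟨x, hx, y, hy, rfl⟩ := Finset.mem_add.1 this
        have hx' := support_monomial_subset hx
        rw [Finset.mem_singleton] at hx'
        subst hx'
        exact Finset.mem_image_of_mem _ hy
      calc _ ≤ (r.support.image (α + ·)).card := Finset.card_le_card h1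
        _ ≤ r.support.card := Finset.card_image_le
        _ ≤ (f.support.erase β).card := Finset.card_le_card hrsupp
        _ < f.support.card := Finset.card_erase_lt_of_mem hβf
    refine absurd (hmin (monomial α 1 * r) fun q => ?_) (not_le.2 hcard)
    have hmonI : q * (monomial α 1 * monomial β (coeff β f)) ∈ I := by
      apply I.mul_mem_left
      rw [monomial_mul, one_mul]
      exact (monomial_mem_iff I _ _ (mem_support_iff.1 hβf)).2 hαβ
    have heq : q * (monomial α 1 * r) = q * monomial α 1 * f
        - q * (monomial α 1 * monomial β (coeff β f)) := by
      simp only [r]; ring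
    rw [heq, sub_eq_add_neg, I.add_mem_iff_left (I.neg_mem hmonI), ← hf]
    constructor
    · intro hq; exact p.mul_mem_right _ hq
    · intro hq
      exact (hp.mem_or_mem hq).resolve_right hα.1
  intro ν hν
  by_contra hcon
  have hc : coeff ν g' = coeff ν g := by
    simp only [g', coeff_sum, coeff_monomial]
    rw [Finset.sum_ite_eq' , if_pos (Finset.mem_filter.2 ⟨hν, hcon⟩)]
  rw [hg'0, coeff_zero] at hc
  exact mem_support_iff.1 hν hc.symm

lemma mon_prime_var {n : ℕ} {K : Type*} [Field K] {p : Ideal (MvPolynomial (Fin n) K)}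
    (hp : p.IsPrime) {ν : Fin n →₀ ℕ} (hν : ν ∈ expSet p) :
    ∃ i, ν i ≠ 0 ∧ X i ∈ p := by
  have h : monomial ν (1 : K) ∈ p := hν
  rw [monomial_eq, C_1, one_mul, Finsupp.prod] at h
  obtain ⟨i, hi, h2⟩ := (hp.prod_mem_iff).1 h
  exact ⟨i, Finsupp.mem_support_iff.1 hi, hp.mem_of_pow_mem _ h2⟩

lemma ass_of_qst {n : ℕ} {K : Type*} [Field K] {I : Ideal (MvPolynomial (Fin n) K)}
    (hI : IsMonIdeal I) (hI0 : I ≠ ⊥) (hQ : QSt (expSet I))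
    (p : Ideal (MvPolynomial (Fin n) K))
    (hpa : p ∈ associatedPrimes (MvPolynomial (Fin n) K) (MvPolynomial (Fin n) K ⧸ I)) :
    ∃ j : Fin n, p = Ideal.span {q | ∃ i : Fin n, j ≤ i ∧ q = X i} := by
  classical
  obtain ⟨hp, hf⟩ := (assoc_iff I p).1 hpa
  have hmon := prime_mon hI hp hf
  obtain ⟨f, hf⟩ := hf
  have hup : ∀ i j : Fin n, i < j → X i ∈ p → X j ∈ p := by
    intro i j hij hi
    rw [hf, mem_iff_supp hI] at hi
    have h1 : ∀ μ ∈ f.support, ∀ᶠ s in Filter.atTop, μ + Finsupp.single j s ∈ expSet I := by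
      intro μ hμ
      obtain ⟨s, hs⟩ := hQ μ i j 1 hij (hi _ (by
        rw [mem_support_iff, add_comm, coeff_X_mul]; exact mem_support_iff.1 hμ))
      filter_upwards [Filter.eventually_ge_atTop s] with t ht
      refine expSet_upper I ?_ hs
      gcongr
    obtain ⟨s, hs⟩ := ((Filter.eventually_all_finset _).2 h1).exists
    refine hp.mem_of_pow_mem s ((hf _).2 ?_)
    rw [f.as_sum, Finset.mul_sum]
    refine I.sum_mem fun μ hμ => ?_
    rw [X_pow_eq_monomial, monomial_mul, one_mul, add_comm]
    exact (monomial_mem_iff I _ _ (mem_support_iff.1 hμ)).2 (hs μ hμ)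
  have hex : ∃ i : Fin n, X i ∈ p := by
    obtain ⟨g, hg, hg0⟩ := Submodule.exists_mem_ne_zero_of_ne_bot hI0
    have hgp : g ∈ p := (hf g).2 (I.mul_mem_right _ hg)
    obtain ⟨ν, hν⟩ := support_nonempty.2 hg0
    obtain ⟨i, -, hi⟩ := mon_prime_var hp (hmon g hgp ν hν)
    exact ⟨i, hi⟩
  obtain ⟨j, hj, hjmin⟩ : ∃ j : Fin n, X j ∈ p ∧ ∀ i, X i ∈ p → j ≤ i := by
    obtain ⟨i, hi⟩ := hex
    have hne : {i : Fin n | X i ∈ p}.Nonempty := ⟨i, hi⟩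
    exact ⟨wellFounded_lt.min _ hne, wellFounded_lt.min_mem _ hne,
      fun k hk => not_lt.1 (wellFounded_lt.not_lt_min {i : Fin n | X i ∈ p} hk)⟩
  refine ⟨j, le_antisymm ?_ ?_⟩
  · intro g hg
    have hset : {q : MvPolynomial (Fin n) K | ∃ i : Fin n, j ≤ i ∧ q = X i}
        = X '' {i | j ≤ i} := by
      ext q; simp [eq_comm]
    rw [hset, mem_ideal_span_X_image]
    intro ν hν
    obtain ⟨i, hi, hi2⟩ := mon_prime_var hp (hmon g hg ν hν)
    exact ⟨i, hjmin i hi2, hi⟩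
  · rw [Ideal.span_le]
    rintro _ ⟨i, hi, rfl⟩
    rcases hi.eq_or_lt with rfl | hlt
    · exact hj
    · exact hup j i hlt hj

/-- Thm. 3.4 (i)⇔(v): a monomial ideal `I` is quasi-stable iff every
associated prime of `P/I` is of the form `⟨x_j, …, x_n⟩`. -/
theorem statement11 {n : ℕ} {K : Type*} [Field K]
    (I : Ideal (MvPolynomial (Fin n) K)) (hImon : IsMonIdeal I) (hI0 : I ≠ ⊥) (hIT : I ≠ ⊤) :
    QuasiStable I ↔
      ∀ p ∈ associatedPrimes (MvPolynomial (Fin n) K) (MvPolynomial (Fin n) K ⧸ I),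
        ∃ j : Fin n, p = Ideal.span {q | ∃ i : Fin n, j ≤ i ∧ q = X i} := by
  have h0 : (0 : Fin n →₀ ℕ) ∉ expSet I := fun h => hIT ((Ideal.eq_top_iff_one _).2 h)
  have hup := expSet_upper I
  constructor
  · rintro ⟨H, hfin, hspan, huniq⟩
    refine ass_of_qst hImon hI0 (qst_of_pb hup h0 hfin ?_ fun ν hν => (huniq ν hν).exists)
    intro μ hμ
    show monomial μ (1 : K) ∈ I
    rw [hspan]
    exact Ideal.subset_span ⟨μ, hμ, rfl⟩
  · intro h
    have hQ := qst_of_ass I h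
    refine ⟨PBset (expSet I), pb_finite hup h0 hQ, le_antisymm ?_ ?_, ?_⟩
    · intro f hf
      rw [mem_ideal_span_monomial_image]
      intro ν hν
      obtain ⟨μ, hμ, hd⟩ := pb_exists h0 _ ν rfl ((mem_iff_supp hImon f).1 hf ν hν)
      exact ⟨μ, hμ, hd.1⟩
    · rw [Ideal.span_le]
      rintro _ ⟨μ, hμ, rfl⟩
      exact hμ.1
    · intro ν hν
      obtain ⟨μ, hμ, hd⟩ := pb_exists h0 _ ν rfl hν
      exact ⟨μ, ⟨hμ, hd⟩, fun μ' h' => pb_unique hup h0 h'.1 hμ h'.2 hd⟩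
end

section
/- Let G be the reduced Gröbner basis of the proper nonzero homogeneous ideal I of P with respect to a term order ≺. Then G is simultaneously a Pommaret basis of I with respect to ≺ if and only if the leading ideal lt(I) is stable. -/
open MvPolynomial

/-- The homogeneous maximal ideal `⟨x_1, …, x_n⟩`. -/
noncomputable def mxI (n : ℕ) (K : Type*) [Field K] : Ideal (MvPolynomial (Fin n) K) :=
  Ideal.span (Set.range X)

/-- The saturation `I : ⟨x_1,…,x_n⟩^∞` of `I`, as a set. -/
def satSet {n : ℕ} {K : Type*} [Field K] (I : Ideal (MvPolynomial (Fin n) K)) :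
    Set (MvPolynomial (Fin n) K) :=
  {f | ∃ s : ℕ, ∀ g ∈ (mxI n K ^ s : Ideal (MvPolynomial (Fin n) K)), g * f ∈ I}

/-- A monomial ideal `I` is stable if for every monomial `t ∈ I` and every index
`cls t < i` also `x_i · t / x_{cls t} ∈ I`. -/
def IsStable {n : ℕ} {K : Type*} [Field K] (I : Ideal (MvPolynomial (Fin n) K)) : Prop :=
  ∀ μ : Fin n →₀ ℕ, μ ≠ 0 → monomial μ (1 : K) ∈ I →
    ∀ c i : Fin n, (c : ℕ) = cls μ → c < i →
      monomial (μ - Finsupp.single c 1 + Finsupp.single i 1) (1 : K) ∈ I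

theorem cls_le_aux {n : ℕ} {μ : Fin n →₀ ℕ} {j : Fin n} (h : μ j ≠ 0) : cls μ ≤ (j : ℕ) :=
  Nat.sInf_le ⟨j.2, h⟩

theorem cls_spec_aux {n : ℕ} {μ : Fin n →₀ ℕ} (h : μ ≠ 0) :
    ∃ c : Fin n, (c : ℕ) = cls μ ∧ μ c ≠ 0 := by
  obtain ⟨j, hj⟩ := Finsupp.ne_iff.1 h
  have hne : {i : ℕ | ∃ hi : i < n, μ ⟨i, hi⟩ ≠ 0}.Nonempty := ⟨j, j.2, hj⟩
  obtain ⟨hi, h2⟩ := Nat.sInf_mem hne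
  exact ⟨⟨_, hi⟩, rfl, h2⟩

theorem comb_uniq {n : ℕ} {H : Set (Fin n →₀ ℕ)}
    (h0 : ∀ h ∈ H, h ≠ 0) (hanti : ∀ h ∈ H, ∀ h' ∈ H, h ≤ h' → h = h')
    {a b ν : Fin n →₀ ℕ} (ha : a ∈ H) (hb : b ∈ H) (hda : InvDiv a ν) (hdb : InvDiv b ν)
    (hcls : cls a ≤ cls b) : a = b := by
  obtain ⟨c, hc, hac⟩ := cls_spec_aux (h0 a ha)
  have key : ∀ j : Fin n, j ≠ c → b j ≤ a j := by
    intro j hj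
    by_cases hjc : (j : ℕ) ≤ cls a
    · have h3 : (j : ℕ) ≠ c := fun h => hj (Fin.ext h)
      by_contra hlt
      have h4 : b j ≠ 0 := by omega
      have := cls_le_aux h4
      omega
    · have h5 : ν j = a j := by
        by_contra h; exact hjc (hda.2 j h)
      rw [← h5]; exact hdb.1 j
  by_cases hbc : b c ≤ a c
  · refine (hanti b hb a ha fun j => ?_).symm
    by_cases hj : j = c
    · subst hj; exact hbc
    · exact key j hj
  · refine hanti a ha b hb fun j => ?_
    have h4 : b c ≠ 0 := by omega
    have h5 := cls_le_aux h4
    by_cases hj : j = c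
    · subst hj; omega
    · by_cases hjc : (j : ℕ) ≤ cls b
      · have h3 : (j : ℕ) ≠ c := fun h => hj (Fin.ext h)
        by_contra hlt
        have h6 : a j ≠ 0 := by
          intro h; apply hlt; rw [h]; exact Nat.zero_le _
        have := cls_le_aux h6
        omega
      · have h7 : ν j = b j := by
          by_contra h; exact hjc (hdb.2 j h)
        rw [← h7]; exact hda.1 j

theorem comb_exists {n : ℕ} {H : Set (Fin n →₀ ℕ)}
    (h0 : ∀ h ∈ H, h ≠ 0)
    (hst : ∀ μ : Fin n →₀ ℕ, μ ≠ 0 → (∃ h ∈ H, h ≤ μ) → ∀ c i : Fin n, (c : ℕ) = cls μ → c < i →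
      ∃ h ∈ H, h ≤ μ - Finsupp.single c 1 + Finsupp.single i 1) :
    ∀ (d : ℕ) (ν : Fin n →₀ ℕ), ν.degree = d → (∃ h ∈ H, h ≤ ν) → ∃ h ∈ H, InvDiv h ν := by
  intro d
  induction d with
  | zero =>
    rintro ν hd ⟨h, hh, hle⟩
    rw [Finsupp.degree_eq_zero_iff] at hd
    subst hd
    exact absurd (le_antisymm hle (zero_le)) (h0 h hh)
  | succ d ih =>
    rintro ν hd ⟨h, hh, hle⟩
    by_cases hν : ν ∈ H
    · exact ⟨ν, hν, le_rfl, fun j hj => absurd rfl hj⟩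
    have hν0 : ν ≠ 0 := by
      rintro rfl; exact h0 h hh (le_antisymm hle (zero_le))
    obtain ⟨c, hc, hνc⟩ := cls_spec_aux hν0
    have hsub : (ν - Finsupp.single c 1) + Finsupp.single c 1 = ν := by
      ext j
      by_cases hj : j = c
      · subst hj; simp; omega
      · simp [Finsupp.single_apply, Ne.symm hj]
    have hU : ∃ h ∈ H, h ≤ ν - Finsupp.single c 1 := by
      have hne : h ≠ ν := by rintro rfl; exact hν hh
      have hex : ∃ j, h j < ν j := by
        by_contra hcon
        push Not at hcon
        exact hne (le_antisymm hle hcon)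
      obtain ⟨j, hj⟩ := hex
      have hjle : h ≤ ν - Finsupp.single j 1 := by
        intro k
        by_cases hk : k = j
        · subst hk; simp; omega
        · simpa [Finsupp.single_apply, Ne.symm hk] using hle k
      by_cases hjc : j = c
      · subst hjc; exact ⟨h, hh, hjle⟩
      have hνj : ν j ≠ 0 := by omega
      have hcj : c < j := by
        have := cls_le_aux hνj
        have h3 : (j : ℕ) ≠ c := fun h => hjc (Fin.ext h)
        rw [Fin.lt_def]; omega
      have hne0 : ν - Finsupp.single j 1 ≠ 0 := by
        intro h; rw [h] at hjle
        exact h0 _ hh (le_antisymm hjle (zero_le))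
      have hcls : (c : ℕ) = cls (ν - Finsupp.single j 1) := by
        apply le_antisymm
        · obtain ⟨e, he, hne⟩ := cls_spec_aux hne0
          rw [← he, hc]
          apply cls_le_aux
          intro h; apply hne; simp [h]
        · apply cls_le_aux
          simpa [Finsupp.single_apply, hjc] using hνc
      obtain ⟨h', hh', hle'⟩ := hst _ hne0 ⟨h, hh, hjle⟩ c j hcls hcj
      refine ⟨h', hh', hle'.trans ?_⟩
      intro k
      by_cases hk : k = j
      · subst hk; simp [Finsupp.single_apply, Ne.symm hjc]; omega
      · simp [Finsupp.single_apply, Ne.symm hk]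
    have hdeg : (ν - Finsupp.single c 1).degree = d := by
      have := congrArg Finsupp.degree hsub
      rw [map_add, Finsupp.degree_single, hd] at this
      omega
    obtain ⟨g, hg, hgd⟩ := ih _ hdeg hU
    have hgle : g ≤ ν := hgd.1.trans tsub_le_self
    refine ⟨g, hg, hgle, fun j hj => ?_⟩
    by_cases hjc : j = c
    · subst hjc
      obtain ⟨e, he, hne⟩ := cls_spec_aux (h0 g hg)
      rw [← he, hc]
      apply cls_le_aux
      have := hgle e
      omega
    · apply hgd.2 j
      simpa [Finsupp.single_apply, Ne.symm hjc] using hj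

theorem comb_stable {n : ℕ} {H : Set (Fin n →₀ ℕ)}
    (hanti : ∀ h ∈ H, ∀ h' ∈ H, h ≤ h' → h = h')
    (hpb : ∀ ν : Fin n →₀ ℕ, (∃ h ∈ H, h ≤ ν) → ∃ h ∈ H, InvDiv h ν)
    (μ : Fin n →₀ ℕ) (hμ : μ ≠ 0) (hU : ∃ h ∈ H, h ≤ μ) (c i : Fin n) (hc : (c : ℕ) = cls μ)
    (hci : c < i) : ∃ h ∈ H, h ≤ μ - Finsupp.single c 1 + Finsupp.single i 1 := by
  obtain ⟨h, hh, hle⟩ := hU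
  obtain ⟨g, hg, hgle, hgd⟩ := hpb (μ + Finsupp.single i 1) ⟨h, hh, hle.trans le_self_add⟩
  have hic : i ≠ c := hci.ne'
  have hμc : μ c ≠ 0 := by
    obtain ⟨e, he, hne⟩ := cls_spec_aux hμ
    have : e = c := Fin.ext (he.trans hc.symm)
    rwa [← this]
  by_cases hlt : g c < μ c
  · refine ⟨g, hg, fun k => ?_⟩
    by_cases hk : k = c
    · subst hk; simp [Finsupp.single_apply, hic]; omega
    · simpa [Finsupp.single_apply, Ne.symm hk] using hgle k
  · exfalso
    have hgc : g c ≠ 0 := by omega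
    have hclsg := cls_le_aux hgc
    have heq : g = μ + Finsupp.single i 1 := by
      ext j
      by_contra hne
      have hj := hgd j (Ne.symm hne)
      by_cases hjc : j = c
      · subst hjc
        have := hgle j
        simp [Finsupp.single_apply, hic] at this hne
        omega
      · have h3 : (j : ℕ) ≠ c := fun h => hjc (Fin.ext h)
        have hjlt : j < c := by rw [Fin.lt_def]; omega
        have hji : i ≠ j := (hjlt.trans hci).ne'
        have hμj : μ j = 0 := by
          by_contra h
          have := cls_le_aux h
          omega
        have := hgle j
        simp [Finsupp.single_apply, hji, hμj] at this hne
        omega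
    have h1 : h = g := hanti h hh g hg (by rw [heq]; exact hle.trans le_self_add)
    have h2 := hle i
    rw [h1, heq] at h2
    simp at h2

theorem mem_span_aux {n : ℕ} {K : Type*} [Field K] (H : Set (Fin n →₀ ℕ)) (ν : Fin n →₀ ℕ) :
    monomial ν (1 : K) ∈ Ideal.span ((fun μ => monomial μ (1 : K)) '' H) ↔ ∃ h ∈ H, h ≤ ν := by
  classical
  rw [MvPolynomial.mem_ideal_span_monomial_image]
  simp [MvPolynomial.support_monomial]

theorem ldeg_zero_aux {n : ℕ} {K : Type*} [Field K] (m : MonomialOrder (Fin n))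
    (f : MvPolynomial (Fin n) K) (h : ldeg m f = 0) : f = C (coeff 0 f) := by
  have h1 : (f.support.sup fun μ => m.toSyn μ) = 0 := by
    unfold ldeg at h
    simpa using h
  ext ν
  by_cases hν : ν ∈ f.support
  · have h2 : m.toSyn ν ≤ 0 := h1 ▸ Finset.le_sup (f := fun μ => m.toSyn μ) hν
    have h3 : m.toSyn ν = 0 := le_antisymm h2 (m.zero_le _)
    have h4 : ν = 0 := by simpa using h3
    subst h4
    simp
  · by_cases h0 : ν = 0
    · subst h0; simp
    · rw [notMem_support_iff.1 hν, coeff_C, if_neg (Ne.symm h0)]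

/-- Thm. 3.6: the reduced Gröbner basis `G` of `I` w.r.t. `m` is
simultaneously a Pommaret basis of `I` iff the leading ideal `lt(I)` is stable. -/
theorem statement14 {n : ℕ} {K : Type*} [Field K] (m : MonomialOrder (Fin n))
    (I : Ideal (MvPolynomial (Fin n) K)) (hI0 : I ≠ ⊥) (hIT : I ≠ ⊤) (hIhom : IsHomIdeal I)
    (G : Finset (MvPolynomial (Fin n) K))
    (hGI : ∀ g ∈ G, g ∈ I) (hG0 : ∀ g ∈ G, g ≠ 0)
    (hmonic : ∀ g ∈ G, MvPolynomial.coeff (ldeg m g) g = 1)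
    (hinj : Set.InjOn (fun g : MvPolynomial (Fin n) K => ldeg m g) ↑G)
    (hGB : ltIdeal m I =
      Ideal.span ((fun g : MvPolynomial (Fin n) K => monomial (ldeg m g) (1 : K)) '' ↑G))
    (hminimal : ∀ g ∈ G, (monomial (ldeg m g) (1 : K)) ∉
      (mxI n K * ltIdeal m I : Ideal (MvPolynomial (Fin n) K)))
    (hreduced : ∀ g ∈ G, ∀ ν ∈ g.support, ν ≠ ldeg m g →
      monomial ν (1 : K) ∉ ltIdeal m I) :
    IsPB m G I ↔ IsStable (ltIdeal m I) := by
  set H : Set (Fin n →₀ ℕ) := (fun g : MvPolynomial (Fin n) K => ldeg m g) '' ↑G with hH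
  have hspan : ltIdeal m I = Ideal.span ((fun μ => monomial μ (1 : K)) '' H) := by
    rw [hGB, hH, Set.image_image]
  have hmem : ∀ ν : Fin n →₀ ℕ, monomial ν (1 : K) ∈ ltIdeal m I ↔ ∃ h ∈ H, h ≤ ν := by
    intro ν; rw [hspan, mem_span_aux]
  have h0 : ∀ h ∈ H, h ≠ 0 := by
    rintro _ ⟨g, hg, rfl⟩ hz
    have h1 := ldeg_zero_aux m g hz
    have h2 : coeff 0 g = 1 := by
      have := hmonic g hg
      simp only at hz
      rwa [hz] at this
    rw [h2, C_1] at h1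
    exact hIT ((Ideal.eq_top_iff_one I).2 (h1 ▸ hGI g hg))
  have hanti : ∀ h ∈ H, ∀ h' ∈ H, h ≤ h' → h = h' := by
    rintro h hh _ ⟨g, hg, rfl⟩ hle
    by_contra hne
    apply hminimal g hg
    simp only at hle hne
    obtain ⟨δ, hδ⟩ := le_iff_exists_add.1 hle
    have hδ0 : δ ≠ 0 := by
      rintro rfl; apply hne; rw [hδ, add_zero]
    obtain ⟨j, hj⟩ := Finsupp.ne_iff.1 hδ0
    have hj : δ j ≠ 0 := hj
    have hdec : Finsupp.single j 1 + (h + (δ - Finsupp.single j 1)) = ldeg m g := by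
      rw [hδ]
      ext k
      by_cases hk : k = j
      · subst hk; simp; omega
      · simp [Finsupp.single_apply, Ne.symm hk]
    have hprod : monomial (ldeg m g) (1 : K)
        = X j * monomial (h + (δ - Finsupp.single j 1)) 1 := by
      rw [← hdec, X, monomial_mul, one_mul]
    rw [hprod]
    exact Ideal.mul_mem_mul (Ideal.subset_span ⟨j, rfl⟩) ((hmem _).2 ⟨h, hh, le_self_add⟩)
  constructor
  · rintro ⟨-, -, -, -, -, hpb⟩ μ hμ hμI c i hc hci
    rw [hmem] at hμI ⊢
    refine comb_stable hanti (fun ν hν => ?_) μ hμ hμI c i hc hci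
    obtain ⟨h, ⟨h1, h2⟩, -⟩ := hpb ν ((hmem ν).2 hν)
    exact ⟨h, h1, h2⟩
  · intro hst
    refine ⟨hGI, hG0, hinj, G.finite_toSet.image _, hspan, fun ν hν => ?_⟩
    obtain ⟨a, ha, hda⟩ := comb_exists h0 (fun μ hμ hU c i hc hci =>
      (hmem _).1 (hst μ hμ ((hmem μ).2 hU) c i hc hci)) _ ν rfl ((hmem ν).1 hν)
    refine ⟨a, ⟨ha, hda⟩, ?_⟩
    rintro b ⟨hb, hdb⟩
    rcases le_total (cls a) (cls b) with h | h
    · exact (comb_uniq h0 hanti ha hb hda hdb h).symm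
    · exact comb_uniq h0 hanti hb ha hdb hda h
end
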